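/- Let c₁, c₂ ∈ ℂ and let F(z) = (z² + c₁)² + c₂. If the forward orbit of 0 under F is bounded and the forward orbit of every w ∈ ℂ with w² = −c₁ under F is bounded, then the alternated Julia set, i.e. the topological frontier of the alternated filled Julia set K_{c₁c₂}, is a connected subset of ℂ. -/

import Mathlib

/-- The alternated orbit of `z₀` under the quadratic maps `z ↦ z² + c₁` (applied at even
indices) and `z ↦ z² + c₂` (applied at odd indices). -/
def altOrbit (c₁ c₂ z₀ : ℂ) : ℕ → ℂ
  | 0 => z₀
  | n + 1 => (altOrbit c₁ c₂ z₀ n) ^ 2 + (if Even n then c₁ else c₂)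

open Set Filter Topology

/-- If a map is both open and closed, the preimage of a preconnected set is preconnected as soon
as it contains a preconnected set containing a whole fibre. -/
theorem IsPreconnected.preimage_of_isOpenMap_of_isClosedMap {X Y : Type*} [TopologicalSpace X]
    [TopologicalSpace Y] {f : X → Y} {S : Set Y} {C : Set X} {p : X} (hS : IsPreconnected S)
    (hfo : IsOpenMap f) (hfc : IsClosedMap f) (hC : IsPreconnected C) (hCS : C ⊆ f ⁻¹' S)
    (hp : p ∈ C) (hfib : ∀ q, f q = f p → q ∈ C) : IsPreconnected (f ⁻¹' S) := by
  have key : ∀ u v : Set X, IsOpen u → IsOpen v → f ⁻¹' S ⊆ u ∪ v → (f ⁻¹' S ∩ v).Nonempty →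
      C ⊆ u → (f ⁻¹' S ∩ (u ∩ v)).Nonempty := by
    intro u v hu hv hsub hnv hCu
    have hcov : S ⊆ f '' v ∪ (f '' uᶜ)ᶜ := by
      intro s hs
      by_cases h : s ∈ f '' uᶜ
      · obtain ⟨x, hx, rfl⟩ := h
        exact Or.inl ⟨x, (hsub hs).resolve_left hx, rfl⟩
      · exact Or.inr h
    obtain ⟨x, hxS, hxv⟩ := hnv
    obtain ⟨s, hs, ⟨b, hbv, rfl⟩, hbu⟩ := hS _ _ (hfo v hv) (hfc _ hu.isClosed_compl).isOpen_compl
      hcov ⟨f x, hxS, x, hxv, rfl⟩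
      ⟨f p, hCS hp, fun ⟨q, hq, hqp⟩ => hq (hCu (hfib q hqp))⟩
    exact ⟨b, hs, by_contra fun h => hbu ⟨b, h, rfl⟩, hbv⟩
  intro u v hu hv hsub hnu hnv
  by_cases hCu : C ⊆ u
  · exact key u v hu hv hsub hnv hCu
  by_cases hCv : C ⊆ v
  · rw [inter_comm u v]
    exact key v u hv hu (union_comm u v ▸ hsub) hnu hCv
  obtain ⟨a, haC, hau⟩ := not_subset.1 hCu
  obtain ⟨b, hbC, hbv⟩ := not_subset.1 hCv
  exact (hC u v hu hv (hCS.trans hsub) ⟨b, hbC, (hsub (hCS hbC)).resolve_right hbv⟩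
    ⟨a, haC, (hsub (hCS haC)).resolve_left hau⟩).mono (inter_subset_inter_left _ hCS)

/-- The intersection of a decreasing sequence of compact connected sets is connected. -/
theorem IsConnected.iInter_of_antitone {X : Type*} [TopologicalSpace X] [T2Space X]
    {s : ℕ → Set X} (hs : Antitone s) (hc : ∀ n, IsCompact (s n)) (hconn : ∀ n, IsConnected (s n)) :
    IsConnected (⋂ n, s n) := by
  refine ⟨IsCompact.nonempty_iInter_of_sequence_nonempty_isCompact_isClosed s
    (fun n => hs n.le_succ) (fun n => (hconn n).nonempty) (hc 0) fun n => (hc n).isClosed, ?_⟩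
  have hcl : IsClosed (⋂ n, s n) := isClosed_iInter fun n => (hc n).isClosed
  have hcpt : IsCompact (⋂ n, s n) := (hc 0).of_isClosed_subset hcl (iInter_subset s 0)
  rw [isPreconnected_closed_iff]
  rintro t t' ht ht' hsub ⟨x, hx, hxt⟩ ⟨y, hy, hyt'⟩
  by_contra hne
  have hdisj : Disjoint ((⋂ n, s n) ∩ t) ((⋂ n, s n) ∩ t') := by
    rw [Set.disjoint_left]
    exact fun z hz hz' => hne ⟨z, hz.1, hz.2, hz'.2⟩
  obtain ⟨U, V, hU, hV, htU, htV, hUV⟩ :=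
    SeparatedNhds.of_isCompact_isCompact (hcpt.inter_right ht) (hcpt.inter_right ht') hdisj
  obtain ⟨n, hn⟩ := exists_subset_nhds_of_isCompact' hs.directed_ge hc
    (fun n => (hc n).isClosed) (U := U ∪ V) fun z hz => (hU.union hV).mem_nhds <|
      (hsub hz).imp (fun h => htU ⟨hz, h⟩) fun h => htV ⟨hz, h⟩
  obtain ⟨z, -, hzU, hzV⟩ := (hconn n).isPreconnected U V hU hV hn
    ⟨x, mem_iInter.1 hx n, htU ⟨hx, hxt⟩⟩ ⟨y, mem_iInter.1 hy n, htV ⟨hy, hyt'⟩⟩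
  exact Set.disjoint_left.1 hUV hzU hzV

/-- A preconnected set `S` surrounds `K` if it is disjoint from `K` and carries a loop `γ` of
period one having odd winding number around each `k ∈ K`, in the sense that `γ - k` has a
continuous antiperiodic square root. -/
structure Surrounds (S K : Set ℂ) : Prop where
  isPreconnected : IsPreconnected S
  disjoint : Disjoint S K
  exists_loop : ∃ γ : ℝ → ℂ, (∀ t, γ t ∈ S) ∧ ∀ k ∈ K, ∃ s : ℝ → ℂ, Continuous s ∧
    (∀ t, s t ^ 2 = γ t - k) ∧ Function.Antiperiodic s 1

theorem Complex.exists_continuous_sq_eq {g : ℝ → ℂ} (hg : Continuous g) (h0 : ∀ t, g t ≠ 0) :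
    ∃ f : ℝ → ℂ, Continuous f ∧ ∀ t, f t ^ 2 = g t := by
  obtain ⟨f, ⟨-, hf⟩, -⟩ := Complex.isCoveringMapOn_exp.existsUnique_continuousMap_lifts
    ⟨g, hg⟩ (Complex.exp_log (h0 0)) h0
  refine ⟨fun t => Complex.exp (f t / 2), by fun_prop, fun t => ?_⟩
  rw [← Complex.exp_nat_mul]
  simpa [mul_div_cancel₀] using congrFun hf t

theorem isOpenMap_sq_add (v : ℂ) : IsOpenMap fun z : ℂ => z ^ 2 + v := by
  have han : AnalyticOnNhd ℂ (fun z : ℂ => z ^ 2 + v) univ := fun z _ => by fun_prop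
  refine han.is_constant_or_isOpenMap.resolve_left ?_
  rintro ⟨w, hw⟩
  have h0 := hw 0
  have h1 := hw 1
  rw [← h0] at h1
  simp at h1

theorem isClosedMap_sq_add (v : ℂ) : IsClosedMap fun z : ℂ => z ^ 2 + v := by
  have heval : (fun z : ℂ => z ^ 2 + v) =
      fun z => (Polynomial.X ^ 2 + Polynomial.C v : Polynomial ℂ).eval z := by
    ext z
    simp
  rw [heval]
  exact Polynomial.isClosedMap_eval _

/-- If `s² = γ - v` and `r² = γ - (a² + v)` with `s` and `r` antiperiodic, then `s - a` has a
continuous square root which is antiperiodic after doubling the period. -/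
theorem exists_antiperiodic_sqrt_sub {s r : ℝ → ℂ} {a : ℂ} (hs : Continuous s)
    (hsa : Function.Antiperiodic s 1) (hr : Continuous r) (hra : Function.Antiperiodic r 1)
    (hr0 : ∀ t, r t ≠ 0) (hsr : ∀ t, r t ^ 2 = s t ^ 2 - a ^ 2) :
    ∃ g : ℝ → ℂ, Continuous g ∧ (∀ t, g t ^ 2 = s t - a) ∧ Function.Antiperiodic g 2 := by
  have hne : ∀ t, s t - a ≠ 0 := fun t h => hr0 t <| by
    rw [← sq_eq_zero_iff, hsr, sub_eq_zero.1 h, sub_self]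
  obtain ⟨g, hg, hgs⟩ := Complex.exists_continuous_sq_eq (g := fun t => s t - a) (by fun_prop) hne
  refine ⟨g, hg, hgs, fun t => ?_⟩
  have hg0 : ∀ t, g t ≠ 0 := fun t h => hne t <| by rw [← hgs, h]; simp
  have hprod : (∀ t, g t * g (t + 1) = Complex.I * r t) ∨
      ∀ t, g t * g (t + 1) = -(Complex.I * r t) := by
    have := isPreconnected_univ.eq_or_eq_neg_of_sq_eq (f := fun t => g t * g (t + 1))
      (g := fun t => Complex.I * r t) (S := univ) (by fun_prop) (by fun_prop)
      (fun t _ => by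
        simp only [Pi.pow_apply, mul_pow, hgs, hsa t, hsr, Complex.I_sq]
        ring)
      (fun {t} _ => mul_ne_zero Complex.I_ne_zero (hr0 t))
    exact this.imp (fun h t => h (mem_univ t)) fun h t => h (mem_univ t)
  have htwo : t + 2 = t + 1 + 1 := by ring
  rw [htwo]
  apply mul_left_cancel₀ (hg0 (t + 1))
  rcases hprod with h | h
  all_goals
    have h1 := h t
    have h2 := h (t + 1)
    rw [hra t] at h2
    linear_combination h2 + h1

/-- Surrounding is preserved under preimages by `z ↦ z² + v` when `v` belongs to the surrounded
set. -/
theorem Surrounds.preimage_sq_add {S K : Set ℂ} (h : Surrounds S K) {v : ℂ} (hv : v ∈ K) :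
    Surrounds ((fun z : ℂ => z ^ 2 + v) ⁻¹' S) ((fun z : ℂ => z ^ 2 + v) ⁻¹' K) := by
  obtain ⟨γ, hγS, hγ⟩ := h.exists_loop
  obtain ⟨s, hs, hsγ, hsa⟩ := hγ v hv
  have hsS : ∀ t, s t ∈ (fun z : ℂ => z ^ 2 + v) ⁻¹' S := fun t => by simp [hsγ, hγS]
  refine ⟨?_, h.disjoint.preimage _, fun t => s (2 * t), fun t => hsS _, fun a ha => ?_⟩
  · refine h.isPreconnected.preimage_of_isOpenMap_of_isClosedMap (isOpenMap_sq_add v)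
      (isClosedMap_sq_add v) (isPreconnected_range hs) (range_subset_iff.2 hsS)
      (mem_range_self 0) fun q hq => ?_
    rcases sq_eq_sq_iff_eq_or_eq_neg.1 (add_right_cancel hq) with h | h
    · exact ⟨0, h.symm⟩
    · exact ⟨0 + 1, by rw [hsa, h]⟩
  · obtain ⟨r, hr, hrγ, hra⟩ := hγ _ ha
    have hr0 : ∀ t, r t ≠ 0 := fun t h0 => by
      have := hrγ t
      rw [h0, zero_pow two_ne_zero, eq_comm, sub_eq_zero] at this
      exact Set.disjoint_left.1 h.disjoint (hγS t) (this ▸ ha)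
    obtain ⟨g, hg, hgs, hga⟩ := exists_antiperiodic_sqrt_sub (a := a) hs hsa hr hra hr0
      fun t => by rw [hrγ, hsγ]; ring
    refine ⟨fun t => g (2 * t), by fun_prop, fun t => hgs _, fun t => ?_⟩
    simpa [mul_add] using hga (2 * t)

theorem surrounds_annulus {R R' : ℝ} (hR : 0 < R) (hRR' : R ≤ R') {K : Set ℂ}
    (hK : ∀ k ∈ K, ‖k‖ < R) : Surrounds {z | R ≤ ‖z‖ ∧ ‖z‖ ≤ R'} K := by
  refine ⟨?_, ?_, fun t => R * Complex.exp (2 * Real.pi * t * Complex.I), fun t => ?_,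
    fun k hk => ?_⟩
  · have himage : {z : ℂ | R ≤ ‖z‖ ∧ ‖z‖ ≤ R'} =
        (fun p : ℝ × ℝ => (p.1 : ℂ) * Complex.exp (p.2 * Complex.I)) '' (Icc R R' ×ˢ univ) := by
      ext z
      constructor
      · exact fun hz => ⟨(‖z‖, z.arg), ⟨hz, mem_univ _⟩, Complex.norm_mul_exp_arg_mul_I z⟩
      · rintro ⟨⟨r, t⟩, ⟨hr, -⟩, rfl⟩
        have : ‖(r : ℂ) * Complex.exp (t * Complex.I)‖ = r := by
          rw [norm_mul, Complex.norm_exp_ofReal_mul_I, mul_one, Complex.norm_real,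
            Real.norm_of_nonneg (hR.le.trans hr.1)]
        simpa only [mem_ofPred_eq, this] using mem_Icc.1 hr
    rw [himage]
    exact (isPreconnected_Icc.prod isPreconnected_univ).image _ (by fun_prop)
  · rw [Set.disjoint_left]
    exact fun z hz hzK => (hK z hzK).not_ge hz.1
  · have : ‖(R : ℂ) * Complex.exp (2 * Real.pi * t * Complex.I)‖ = R := by
      have := Complex.norm_exp_ofReal_mul_I (2 * Real.pi * t)
      push_cast at this
      rw [norm_mul, this, mul_one, Complex.norm_real, Real.norm_of_nonneg hR.le]
    simp only [mem_ofPred_eq, this, le_refl, hRR', and_self]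
  · have hR0 : (R : ℂ) ≠ 0 := Complex.ofReal_ne_zero.2 hR.ne'
    have hslit : ∀ t : ℝ,
        1 + -(k / (R * Complex.exp (2 * Real.pi * t * Complex.I))) ∈ Complex.slitPlane := by
      intro t
      apply Complex.mem_slitPlane_of_norm_lt_one
      have := Complex.norm_exp_ofReal_mul_I (2 * Real.pi * t)
      push_cast at this
      rw [norm_neg, norm_div, norm_mul, this, mul_one, Complex.norm_real,
        Real.norm_of_nonneg hR.le, div_lt_one hR]
      exact hK k hk
    refine ⟨fun t => (√R : ℂ) * Complex.exp (Real.pi * t * Complex.I) * Complex.exp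
      (Complex.log (1 + -(k / (R * Complex.exp (2 * Real.pi * t * Complex.I)))) / 2),
      ?_, fun t => ?_, fun t => ?_⟩
    · refine Continuous.mul (by fun_prop) (Complex.continuous_exp.comp ?_)
      refine Continuous.div_const (Continuous.clog ?_ hslit) 2
      refine continuous_const.add (Continuous.neg ?_)
      exact continuous_const.div (by fun_prop) fun t => mul_ne_zero hR0 (Complex.exp_ne_zero _)
    · have hsqrt : (√R : ℂ) ^ 2 = R := by
        rw [← Complex.ofReal_pow, Real.sq_sqrt hR.le]
      rw [mul_pow, mul_pow, hsqrt, ← Complex.exp_nat_mul, ← Complex.exp_nat_mul]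
      have h1 : ((2 : ℕ) : ℂ) * (Real.pi * t * Complex.I) = 2 * Real.pi * t * Complex.I := by
        push_cast; ring
      have h2 : ∀ z : ℂ, ((2 : ℕ) : ℂ) * (z / 2) = z := fun z => by push_cast; ring
      rw [h1, h2, Complex.exp_log (Complex.slitPlane_ne_zero (hslit t))]
      have := Complex.exp_ne_zero (2 * Real.pi * t * Complex.I)
      field_simp
      ring
    · have h1 : (Real.pi * ((t + 1 : ℝ) : ℂ) * Complex.I) =
          Real.pi * t * Complex.I + Real.pi * Complex.I := by push_cast; ring
      have h2 : (2 * Real.pi * ((t + 1 : ℝ) : ℂ) * Complex.I) =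
          2 * Real.pi * t * Complex.I + 2 * Real.pi * Complex.I := by push_cast; ring
      simp only [h1, h2, Complex.exp_add, Complex.exp_pi_mul_I, Complex.exp_two_pi_mul_I]
      ring_nf

section Escape

variable {F : ℂ → ℂ} {R : ℝ}

theorem two_pow_mul_le_norm_iterate (hF : ∀ z, R ≤ ‖z‖ → 2 * ‖z‖ ≤ ‖F z‖) {z : ℂ}
    (hz : R ≤ ‖z‖) (n : ℕ) : 2 ^ n * ‖z‖ ≤ ‖F^[n] z‖ := by
  induction n generalizing z with
  | zero => simp
  | succ n ih =>
    have h := hF z hz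
    rw [Function.iterate_succ_apply, pow_succ, mul_assoc]
    exact (mul_le_mul_of_nonneg_left h (by positivity)).trans
      (ih (hz.trans (by linarith [norm_nonneg z])))

theorem norm_le_norm_iterate (hF : ∀ z, R ≤ ‖z‖ → 2 * ‖z‖ ≤ ‖F z‖) {z : ℂ}
    (hz : R ≤ ‖z‖) (n : ℕ) : ‖z‖ ≤ ‖F^[n] z‖ :=
  (le_mul_of_one_le_left (norm_nonneg z) (one_le_pow₀ one_le_two)).trans
    (two_pow_mul_le_norm_iterate hF hz n)

theorem exists_lt_norm_iterate (hR : 0 < R) (hF : ∀ z, R ≤ ‖z‖ → 2 * ‖z‖ ≤ ‖F z‖) {z : ℂ}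
    (hz : R ≤ ‖z‖) (M : ℝ) : ∃ n, M < ‖F^[n] z‖ := by
  obtain ⟨n, hn⟩ := pow_unbounded_of_one_lt (M / ‖z‖) one_lt_two
  rw [div_lt_iff₀ (hR.trans_le hz)] at hn
  exact ⟨n, hn.trans_le (two_pow_mul_le_norm_iterate hF hz n)⟩

theorem norm_iterate_lt_of_bounded (hR : 0 < R) (hF : ∀ z, R ≤ ‖z‖ → 2 * ‖z‖ ≤ ‖F z‖) {z : ℂ}
    {M : ℝ} (hM : ∀ n, ‖F^[n] z‖ ≤ M) (n : ℕ) : ‖F^[n] z‖ < R := by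
  by_contra! h
  obtain ⟨m, hm⟩ := exists_lt_norm_iterate hR hF h M
  rw [← Function.iterate_add_apply] at hm
  exact (hM _).not_gt hm

/-- If all preimages of a fundamental annulus are connected, then so is the frontier of the set of
nonescaping points. -/
theorem isConnected_frontier_of_isConnected_preimage_annulus {R' : ℝ} (hR : 0 < R)
    (hRR' : R ≤ R') (hF : ∀ z, R ≤ ‖z‖ → 2 * ‖z‖ ≤ ‖F z‖) (hF' : ∀ z, ‖z‖ ≤ R → ‖F z‖ ≤ R')
    (hcont : Continuous F) (hsurj : Function.Surjective F)
    (hA : ∀ n, IsConnected (F^[n] ⁻¹' {z | R ≤ ‖z‖ ∧ ‖z‖ ≤ R'})) :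
    IsConnected (frontier {z | ∀ n, ‖F^[n] z‖ < R}) := by
  set K : Set ℂ := {z | ∀ n, ‖F^[n] z‖ < R} with hK
  set A : Set ℂ := {z | R ≤ ‖z‖ ∧ ‖z‖ ≤ R'} with hAdef
  let B : ℕ → Set ℂ := fun n => ⋃ m, F^[n + m] ⁻¹' A
  have hBanti : Antitone B := by
    intro n m hnm
    refine iUnion_subset fun i => ?_
    obtain ⟨j, rfl⟩ := Nat.exists_eq_add_of_le hnm
    rw [add_assoc]
    exact subset_iUnion (fun l => F^[n + l] ⁻¹' A) (j + i)
  have hBconn : ∀ n, IsConnected (B n) := by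
    refine fun n => IsConnected.iUnion_of_chain (fun m => hA _) fun m => ?_
    have hRnorm : ‖(R : ℂ)‖ = R := by rw [Complex.norm_real, Real.norm_of_nonneg hR.le]
    obtain ⟨z, hz⟩ := hsurj.iterate (n + m) (R : ℂ)
    refine ⟨z, ?_, ?_⟩
    · simp [hAdef, hz, abs_of_pos hR, hRR']
    · have : F^[n + (m + 1)] z = F R := by
        rw [← add_assoc, Function.iterate_succ_apply', hz]
      have h := hF R hRnorm.ge
      rw [hRnorm] at h
      simp only [Nat.succ_eq_succ, Nat.succ_eq_add_one, mem_preimage, this]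
      exact ⟨by linarith, hF' _ hRnorm.le⟩
  have hBbdd : ∀ n, B n ⊆ Metric.closedBall 0 R' := by
    refine fun n => iUnion_subset fun m z hz => ?_
    rw [mem_closedBall_zero_iff]
    rcases le_total R ‖z‖ with h | h
    · exact (norm_le_norm_iterate hF h _).trans hz.2
    · exact h.trans hRR'
  have hBcpt : ∀ n, IsCompact (closure (B n)) := fun n =>
    (isCompact_closedBall 0 R').of_isClosed_subset isClosed_closure
      (closure_minimal (hBbdd n) Metric.isClosed_closedBall)
  have hBK : ∀ n, B n ⊆ Kᶜ := fun n => iUnion_subset fun m z hz hzK => (hzK _).not_ge hz.1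
  have hfront : frontier K = ⋂ n, closure (B n) := by
    apply Subset.antisymm
    · refine fun z hz => mem_iInter.2 fun n => ?_
      rw [mem_closure_iff_nhds]
      intro U hU
      have hzcl : ∀ m, ‖F^[m] z‖ ≤ R := by
        have hcl : IsClosed {z | ∀ m, ‖F^[m] z‖ ≤ R} := by
          simp only [ofPred_forall]
          exact isClosed_iInter fun m => isClosed_le (hcont.iterate m).norm continuous_const
        exact closure_minimal (fun y hy m => (hy m).le) hcl (frontier_subset_closure hz)
      have hzK : z ∈ K := norm_iterate_lt_of_bounded hR hF hzcl
      have hnear : ∀ᶠ y in 𝓝 z, ∀ m ∈ Finset.range (n + 1), ‖F^[m] y‖ < R := by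
        rw [eventually_all_finset]
        exact fun m _ => (hcont.iterate m).norm.continuousAt.eventually_lt_const (hzK m)
      rw [frontier_eq_closure_inter_closure] at hz
      obtain ⟨y, ⟨hyU, hy⟩, hyK⟩ := mem_closure_iff_nhds.1 hz.2 _ (inter_mem hU hnear)
      have hex : ∃ m, R ≤ ‖F^[m] y‖ := by simpa [hK] using hyK
      classical
      obtain ⟨l, hl⟩ : ∃ l, Nat.find hex = n + l + 1 := by
        have : n < Nat.find hex := by
          by_contra! h
          exact (hy _ (Finset.mem_range.2 (Nat.lt_succ_of_le h))).not_ge (Nat.find_spec hex)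
        exact ⟨Nat.find hex - n - 1, by omega⟩
      refine ⟨y, hyU, mem_iUnion.2 ⟨l + 1, ?_⟩⟩
      have h1 := Nat.find_spec hex
      have h2 := Nat.find_min hex (m := n + l) (by omega)
      rw [hl] at h1
      refine ⟨h1, ?_⟩
      rw [← add_assoc, Function.iterate_succ_apply']
      exact hF' _ (not_le.1 h2).le
    · intro z hz
      rw [mem_iInter] at hz
      rw [frontier_eq_closure_inter_closure]
      refine ⟨subset_closure ?_, closure_mono (hBK 0) (hz 0)⟩
      by_contra hzK
      obtain ⟨m, hm⟩ : ∃ m, R ≤ ‖F^[m] z‖ := by simpa [hK] using hzK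
      obtain ⟨l, hl⟩ := exists_lt_norm_iterate hR hF hm R'
      rw [← Function.iterate_add_apply] at hl
      obtain ⟨y, hy, hyB⟩ := mem_closure_iff_nhds.1 (hz (l + m)) {y | R' < ‖F^[l + m] y‖}
        ((hcont.iterate (l + m)).norm.continuousAt.eventually_const_lt hl)
      obtain ⟨i, hi⟩ := mem_iUnion.1 hyB
      have h3 := norm_le_norm_iterate hF (hRR'.trans hy.le) i
      rw [← Function.iterate_add_apply, add_comm i] at h3
      exact (hy.trans_le h3).not_ge hi.2
  rw [hfront]
  exact IsConnected.iInter_of_antitone (fun n m h => closure_mono (hBanti h)) hBcpt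
    fun n => (hBconn n).closure

end Escape

theorem altOrbit_two_mul (c₁ c₂ z : ℂ) (n : ℕ) :
    altOrbit c₁ c₂ z (2 * n) = (fun z : ℂ => (z ^ 2 + c₁) ^ 2 + c₂)^[n] z := by
  induction n with
  | zero => rfl
  | succ n ih =>
    rw [Function.iterate_succ_apply', ← ih, mul_add_one]
    simp [altOrbit]

theorem altOrbit_two_mul_add_one (c₁ c₂ z : ℂ) (n : ℕ) :
    altOrbit c₁ c₂ z (2 * n + 1) = ((fun z : ℂ => (z ^ 2 + c₁) ^ 2 + c₂)^[n] z) ^ 2 + c₁ := by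
  simp [altOrbit, altOrbit_two_mul]

theorem two_mul_norm_le_norm_sq_add {z c : ℂ} (h : 2 + ‖c‖ ≤ ‖z‖) :
    2 * ‖z‖ ≤ ‖z ^ 2 + c‖ := by
  have h1 : ‖z‖ ^ 2 ≤ ‖z ^ 2 + c‖ + ‖c‖ := by
    rw [← norm_pow]
    exact norm_le_add_norm_add _ _
  nlinarith [norm_nonneg c, norm_nonneg z]

theorem surjective_sq_add (c : ℂ) : Function.Surjective fun z : ℂ => z ^ 2 + c := fun w => by
  obtain ⟨z, hz⟩ := IsAlgClosed.exists_pow_nat_eq (w - c) two_pos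
  exact ⟨z, by simp [hz]⟩

/-- Let `F(z) = (z² + c₁)² + c₂`. If the forward orbit of `0` under `F`
is bounded and the forward orbit of every square root of `-c₁` under `F` is bounded,
then the alternated Julia set (the frontier of the alternated filled Julia set
`K_{c₁c₂}`) is connected. -/
theorem alternated_julia_isConnected_of_critical_orbits_bounded (c₁ c₂ : ℂ)
    (h0 : ∃ M : ℝ, 0 ≤ M ∧
      ∀ n : ℕ, ‖(fun z : ℂ => (z ^ 2 + c₁) ^ 2 + c₂)^[n] 0‖ ≤ M)
    (hw : ∀ w : ℂ, w ^ 2 = -c₁ →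
      ∃ M : ℝ, 0 ≤ M ∧ ∀ n : ℕ, ‖(fun z : ℂ => (z ^ 2 + c₁) ^ 2 + c₂)^[n] w‖ ≤ M) :
    IsConnected (frontier {z₀ : ℂ |
      ∃ M : ℝ, 0 ≤ M ∧ ∀ n : ℕ, ‖altOrbit c₁ c₂ z₀ n‖ ≤ M}) := by
  set F : ℂ → ℂ := fun z => (z ^ 2 + c₁) ^ 2 + c₂ with hFdef
  obtain ⟨R, hRdef⟩ : ∃ R, R = 2 + ‖c₁‖ + ‖c₂‖ := ⟨_, rfl⟩
  obtain ⟨R', hR'def⟩ : ∃ R', R' = (R ^ 2 + ‖c₁‖) ^ 2 + ‖c₂‖ := ⟨_, rfl⟩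
  have hc₁ := norm_nonneg c₁
  have hc₂ := norm_nonneg c₂
  have hR : 0 < R := by linarith
  have hRR' : R ≤ R' := by
    have h1 : R ≤ R ^ 2 + ‖c₁‖ := by nlinarith
    have h2 : R ^ 2 + ‖c₁‖ ≤ (R ^ 2 + ‖c₁‖) ^ 2 := by nlinarith
    linarith
  have hF : ∀ z, R ≤ ‖z‖ → 2 * ‖z‖ ≤ ‖F z‖ := fun z hz => by
    have h1 : 2 * ‖z‖ ≤ ‖z ^ 2 + c₁‖ := two_mul_norm_le_norm_sq_add (by linarith)
    have h2 : 2 * ‖z ^ 2 + c₁‖ ≤ ‖F z‖ := two_mul_norm_le_norm_sq_add (by linarith)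
    linarith
  have hF' : ∀ z, ‖z‖ ≤ R → ‖F z‖ ≤ R' := fun z hz => by
    have h1 : ‖z ^ 2 + c₁‖ ≤ R ^ 2 + ‖c₁‖ := (norm_add_le _ _).trans (by rw [norm_pow]; gcongr)
    calc ‖F z‖ ≤ ‖z ^ 2 + c₁‖ ^ 2 + ‖c₂‖ := (norm_add_le _ _).trans (by rw [norm_pow])
      _ ≤ R' := by rw [hR'def]; gcongr
  have hcont : Continuous F := by fun_prop
  have hsurj : Function.Surjective F := (surjective_sq_add c₂).comp (surjective_sq_add c₁)
  set K : Set ℂ := {z | ∀ n, ‖F^[n] z‖ < R} with hK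
  have hfilled : {z₀ : ℂ | ∃ M : ℝ, 0 ≤ M ∧ ∀ n : ℕ, ‖altOrbit c₁ c₂ z₀ n‖ ≤ M} = K := by
    ext z
    constructor
    · rintro ⟨M, -, hM⟩
      exact norm_iterate_lt_of_bounded hR hF fun n => altOrbit_two_mul c₁ c₂ z n ▸ hM (2 * n)
    · refine fun hz => ⟨R ^ 2 + R + ‖c₁‖, by positivity, fun n => ?_⟩
      obtain ⟨m, rfl | rfl⟩ := n.even_or_odd'
      · rw [altOrbit_two_mul]
        linarith [hz m, sq_nonneg R]
      · rw [altOrbit_two_mul_add_one]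
        have h1 : ‖F^[m] z‖ ^ 2 ≤ R ^ 2 := by gcongr; exact (hz m).le
        refine (norm_add_le _ _).trans ?_
        rw [norm_pow]
        linarith
  have hFK : F ⁻¹' K = K := by
    ext z
    constructor
    · intro hz
      have hM : ∀ n, ‖F^[n] z‖ ≤ max R ‖z‖ := by
        rintro (_ | n)
        · exact le_max_right _ _
        · exact (hz n).le.trans (le_max_left _ _)
      exact norm_iterate_lt_of_bounded hR hF hM
    · exact fun hz n => hz (n + 1)
  have h0K : (0 : ℂ) ∈ K := by
    obtain ⟨M, -, hM⟩ := h0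
    exact norm_iterate_lt_of_bounded hR hF hM
  have hc₂K : c₂ ∈ K := by
    obtain ⟨w, hwc⟩ := IsAlgClosed.exists_pow_nat_eq (-c₁) two_pos
    obtain ⟨M, -, hM⟩ := hw w hwc
    have hwK : w ∈ F ⁻¹' K := hFK.ge <| norm_iterate_lt_of_bounded hR hF hM
    simpa [hFdef, hwc] using hwK
  have hc₁K : c₁ ∈ (fun z : ℂ => z ^ 2 + c₂) ⁻¹' K := by
    have : F 0 ∈ K := hFK.ge h0K
    simpa [hFdef] using this
  have hsurr : ∀ n, Surrounds (F^[n] ⁻¹' {z | R ≤ ‖z‖ ∧ ‖z‖ ≤ R'}) K := by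
    intro n
    induction n with
    | zero => exact surrounds_annulus hR hRR' fun k hk => hk 0
    | succ n ih =>
      have h := (ih.preimage_sq_add hc₂K).preimage_sq_add hc₁K
      rw [← hFK]
      exact h
  rw [hfilled]
  refine isConnected_frontier_of_isConnected_preimage_annulus hR hRR' hF hF' hcont hsurj
    fun n => ⟨?_, (hsurr n).isPreconnected⟩
  obtain ⟨γ, hγ, -⟩ := (hsurr n).exists_loop
  exact ⟨γ 0, hγ 0⟩
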